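/- Let γ > 0, R(z) = Π_S(z) - M_γ⁻¹(2Π_S(z) - z), and let Z* = {z : R(z) = 0} be nonempty. Suppose z ∈ ℝ^{n+m} and τ > 0 satisfy ‖R(z)‖ ≥ τ · dist(z, Z*). Then the duality gap of the projected point satisfies gap(Π_S(z)) ≤ √2 ‖A‖ ‖R(z)‖ / τ, where ‖A‖ is the operator (spectral) norm of A. -/

import Mathlib

open Matrix
open scoped InnerProductSpace

noncomputable section

/-- The probability simplex `Δᵈ = {x ∈ ℝᵈ : xᵢ ≥ 0, ∑ᵢ xᵢ = 1}` in Euclidean space. -/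
def simplex (d : ℕ) : Set (EuclideanSpace ℝ (Fin d)) :=
  {x | (∀ i, 0 ≤ x i) ∧ ∑ i, x i = 1}

/-- `S = Δⁿ × Δᵐ ⊆ ℝ^{n+m}`, with coordinates indexed by `Fin n ⊕ Fin m`. -/
def gameSet (n m : ℕ) : Set (EuclideanSpace ℝ (Fin n ⊕ Fin m)) :=
  {z | (∀ i, 0 ≤ z i) ∧ (∑ i : Fin n, z (Sum.inl i)) = 1 ∧ (∑ j : Fin m, z (Sum.inr j)) = 1}

/-- The skew block matrix `K = [[0, A], [-Aᵀ, 0]]`. -/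
def Kmat {n m : ℕ} (A : Matrix (Fin n) (Fin m) ℝ) :
    Matrix (Fin n ⊕ Fin m) (Fin n ⊕ Fin m) ℝ :=
  Matrix.fromBlocks 0 A (-Aᵀ) 0

/-- The block matrix `M_γ = [[I, γA], [-γAᵀ, I]] = I + γK`. -/
def Mmat {n m : ℕ} (A : Matrix (Fin n) (Fin m) ℝ) (γ : ℝ) :
    Matrix (Fin n ⊕ Fin m) (Fin n ⊕ Fin m) ℝ :=
  1 + γ • Kmat A

/-- The game operator `F(x, y) = (A y, -Aᵀ x)`. -/
def Fop {n m : ℕ} (A : Matrix (Fin n) (Fin m) ℝ)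
    (z : EuclideanSpace ℝ (Fin n ⊕ Fin m)) : EuclideanSpace ℝ (Fin n ⊕ Fin m) :=
  Matrix.toEuclideanLin (Kmat A) z

/-- The operator (spectral) norm of a matrix, induced by Euclidean norms. -/
def opNorm {n m : ℕ} (A : Matrix (Fin n) (Fin m) ℝ) : ℝ :=
  ‖LinearMap.toContinuousLinearMap (Matrix.toEuclideanLin A)‖

/-- The duality gap `gap(x, y) = max_{y'∈Δᵐ} xᵀAy' - min_{x'∈Δⁿ} x'ᵀAy`. -/
def gap {n m : ℕ} (A : Matrix (Fin n) (Fin m) ℝ)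
    (z : EuclideanSpace ℝ (Fin n ⊕ Fin m)) : ℝ :=
  sSup ((fun y' : EuclideanSpace ℝ (Fin m) =>
      ∑ i : Fin n, ∑ j : Fin m, z (Sum.inl i) * A i j * y' j) '' simplex m)
    - sInf ((fun x' : EuclideanSpace ℝ (Fin n) =>
      ∑ i : Fin n, ∑ j : Fin m, x' i * A i j * z (Sum.inr j)) '' simplex n)

/-- The matrix bilinear form is bounded by the operator norm. -/
theorem abs_bilinear_le_opNorm {n m : ℕ} (A : Matrix (Fin n) (Fin m) ℝ)
    (x : EuclideanSpace ℝ (Fin n)) (y : EuclideanSpace ℝ (Fin m)) :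
    |∑ i, ∑ j, x i * A i j * y j| ≤ opNorm A * ‖x‖ * ‖y‖ := by
  have key : ∑ i, ∑ j, x i * A i j * y j = ⟪x, Matrix.toEuclideanLin A y⟫_ℝ := by
    simp only [PiLp.inner_apply, Matrix.toLpLin_apply, Matrix.mulVec, dotProduct,
      RCLike.inner_apply, conj_trivial, Finset.sum_mul]
    exact Finset.sum_congr rfl fun i _ => Finset.sum_congr rfl fun j _ => by ring
  rw [key]
  calc |⟪x, Matrix.toEuclideanLin A y⟫_ℝ|
      ≤ ‖x‖ * ‖Matrix.toEuclideanLin A y‖ := abs_real_inner_le_norm _ _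
    _ ≤ ‖x‖ * (opNorm A * ‖y‖) := by
        gcongr
        exact (LinearMap.toContinuousLinearMap (Matrix.toEuclideanLin A)).le_opNorm y
    _ = opNorm A * ‖x‖ * ‖y‖ := by ring

theorem inner_Fop {n m : ℕ} (A : Matrix (Fin n) (Fin m) ℝ)
    (v s : EuclideanSpace ℝ (Fin n ⊕ Fin m)) :
    ⟪Fop A v, s⟫_ℝ = (∑ i, ∑ j, s (Sum.inl i) * A i j * v (Sum.inr j))
      - ∑ i, ∑ j, v (Sum.inl i) * A i j * s (Sum.inr j) := by
  simp only [Fop, Kmat, PiLp.inner_apply, Matrix.toLpLin_apply, Matrix.mulVec, dotProduct,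
    RCLike.inner_apply, conj_trivial, Fintype.sum_sum_type, Matrix.fromBlocks_apply₁₁,
    Matrix.fromBlocks_apply₁₂, Matrix.fromBlocks_apply₂₁, Matrix.fromBlocks_apply₂₂,
    Matrix.zero_apply, Matrix.neg_apply, Matrix.transpose_apply, zero_mul,
    Finset.sum_const_zero, zero_add, add_zero, Finset.mul_sum]
  rw [Finset.sum_comm (f := fun i j => v (Sum.inl i) * A i j * s (Sum.inr j)), sub_eq_add_neg,
    ← Finset.sum_neg_distrib]
  simp only [← Finset.sum_neg_distrib]
  congr 1 <;>
    exact Finset.sum_congr rfl fun i _ => Finset.sum_congr rfl fun j _ => by ring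

theorem inner_Fop_self {n m : ℕ} (A : Matrix (Fin n) (Fin m) ℝ)
    (v : EuclideanSpace ℝ (Fin n ⊕ Fin m)) : ⟪Fop A v, v⟫_ℝ = 0 := by
  rw [inner_Fop, sub_self]

theorem abs_inner_Fop_le {n m : ℕ} (A : Matrix (Fin n) (Fin m) ℝ)
    (v s : EuclideanSpace ℝ (Fin n ⊕ Fin m)) :
    |⟪Fop A v, s⟫_ℝ| ≤ opNorm A * ‖v‖ * ‖s‖ := by
  let fst (u : EuclideanSpace ℝ (Fin n ⊕ Fin m)) : EuclideanSpace ℝ (Fin n) :=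
    WithLp.toLp 2 fun i => u (Sum.inl i)
  let snd (u : EuclideanSpace ℝ (Fin n ⊕ Fin m)) : EuclideanSpace ℝ (Fin m) :=
    WithLp.toLp 2 fun j => u (Sum.inr j)
  have norm_sq (u) : ‖u‖ ^ 2 = ‖fst u‖ ^ 2 + ‖snd u‖ ^ 2 := by
    simp [EuclideanSpace.norm_sq_eq, fst, snd]
  have hsv := abs_bilinear_le_opNorm A (fst s) (snd v)
  have hvs := abs_bilinear_le_opNorm A (fst v) (snd s)
  have hA : 0 ≤ opNorm A := norm_nonneg _
  have hcs : ‖fst s‖ * ‖snd v‖ + ‖fst v‖ * ‖snd s‖ ≤ ‖v‖ * ‖s‖ := by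
    refine abs_le_of_sq_le_sq' ?_ (by positivity) |>.2
    rw [mul_pow, norm_sq v, norm_sq s]
    nlinarith [sq_nonneg (‖fst s‖ * ‖fst v‖ - ‖snd v‖ * ‖snd s‖)]
  rw [inner_Fop]
  calc _ ≤ _ := abs_sub _ _
    _ ≤ opNorm A * ‖fst s‖ * ‖snd v‖ + opNorm A * ‖fst v‖ * ‖snd s‖ := add_le_add hsv hvs
    _ = opNorm A * (‖fst s‖ * ‖snd v‖ + ‖fst v‖ * ‖snd s‖) := by ring
    _ ≤ opNorm A * (‖v‖ * ‖s‖) := by gcongr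
    _ = opNorm A * ‖v‖ * ‖s‖ := by ring

theorem toEuclideanLin_Mmat {n m : ℕ} (A : Matrix (Fin n) (Fin m) ℝ) (γ : ℝ)
    (v : EuclideanSpace ℝ (Fin n ⊕ Fin m)) :
    Matrix.toEuclideanLin (Mmat A γ) v = v + γ • Fop A v := by
  simp [Mmat, Fop]

theorem isUnit_det_Mmat {n m : ℕ} (A : Matrix (Fin n) (Fin m) ℝ) (γ : ℝ) :
    IsUnit (Mmat A γ).det := by
  rw [isUnit_iff_ne_zero]
  intro hdet
  obtain ⟨v, hv, hMv⟩ := Matrix.exists_mulVec_eq_zero_iff.mpr hdet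
  let u : EuclideanSpace ℝ (Fin n ⊕ Fin m) := WithLp.toLp 2 v
  have hu : u + γ • Fop A u = 0 := by
    rw [← toEuclideanLin_Mmat, Matrix.toLpLin_apply]
    simp [u, hMv]
  have hinner : ⟪u + γ • Fop A u, u⟫_ℝ = 0 := by rw [hu, inner_zero_left]
  rw [inner_add_left, real_inner_smul_left, inner_Fop_self, mul_zero, add_zero,
    inner_self_eq_zero] at hinner
  exact hv (by simpa [u] using hinner)

theorem convex_gameSet (n m : ℕ) : Convex ℝ (gameSet n m) := by
  rintro x ⟨hx, hx₁, hx₂⟩ y ⟨hy, hy₁, hy₂⟩ a b ha hb hab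
  refine ⟨fun i => ?_, ?_, ?_⟩
  · have := hx i
    have := hy i
    simp only [PiLp.add_apply, PiLp.smul_apply, smul_eq_mul]
    positivity
  · simp [Finset.sum_add_distrib, ← Finset.mul_sum, hx₁, hy₁, hab]
  · simp [Finset.sum_add_distrib, ← Finset.mul_sum, hx₂, hy₂, hab]

theorem norm_le_sqrt_two_of_mem_gameSet {n m : ℕ} {s : EuclideanSpace ℝ (Fin n ⊕ Fin m)}
    (hs : s ∈ gameSet n m) : ‖s‖ ≤ Real.sqrt 2 := by
  obtain ⟨hnonneg, hl, hr⟩ := hs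
  refine Real.le_sqrt_of_sq_le ?_
  have hle (k) : s k ≤ 1 := by
    rcases k with i | j
    · rw [← hl]
      exact Finset.single_le_sum (f := fun i => s (Sum.inl i)) (fun i _ => hnonneg _)
        (Finset.mem_univ i)
    · rw [← hr]
      exact Finset.single_le_sum (f := fun j => s (Sum.inr j)) (fun j _ => hnonneg _)
        (Finset.mem_univ j)
  calc ‖s‖ ^ 2 = ∑ k, s k ^ 2 := by simp [EuclideanSpace.norm_sq_eq]
    _ ≤ ∑ k, s k := Finset.sum_le_sum fun k _ => by nlinarith [hnonneg k, hle k]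
    _ = 2 := by rw [Fintype.sum_sum_type, hl, hr]; norm_num

/-- A nearest point of a convex set satisfies the obtuse-angle inequality. -/
theorem inner_sub_nearest_le_zero {E : Type*} [NormedAddCommGroup E] [InnerProductSpace ℝ E]
    {S : Set E} (hS : Convex ℝ S) {z p : E} (hp : p ∈ S) (hmin : ∀ w ∈ S, ‖z - p‖ ≤ ‖z - w‖)
    {w : E} (hw : w ∈ S) : ⟪z - p, w - p⟫_ℝ ≤ 0 := by
  refine (norm_eq_iInf_iff_real_inner_le_zero hS hp).mp ?_ w hw
  have : Nonempty S := ⟨⟨p, hp⟩⟩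
  refine le_antisymm (le_ciInf fun w => hmin w w.2) ?_
  exact ciInf_le ⟨0, by rintro _ ⟨w, rfl⟩; exact norm_nonneg _⟩ (⟨p, hp⟩ : S)

/-- Nearest points of a convex set are nonexpansive in the base point. -/
theorem norm_nearest_sub_nearest_le {E : Type*} [NormedAddCommGroup E] [InnerProductSpace ℝ E]
    {S : Set E} (hS : Convex ℝ S) {a b p q : E} (hp : p ∈ S) (hq : q ∈ S)
    (hpmin : ∀ w ∈ S, ‖a - p‖ ≤ ‖a - w‖) (hqmin : ∀ w ∈ S, ‖b - q‖ ≤ ‖b - w‖) :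
    ‖p - q‖ ≤ ‖a - b‖ := by
  have hpq := inner_sub_nearest_le_zero hS hp hpmin hq
  have hqp := inner_sub_nearest_le_zero hS hq hqmin hp
  have hid : ⟪a - p, q - p⟫_ℝ + ⟪b - q, p - q⟫_ℝ = ‖p - q‖ ^ 2 - ⟪a - b, p - q⟫_ℝ := by
    rw [← real_inner_self_eq_norm_sq, ← neg_sub p q, inner_neg_right, ← sub_eq_neg_add,
      ← inner_sub_left, ← inner_sub_left]
    congr 1
    abel
  have hcs := real_inner_le_norm (a - b) (p - q)
  by_contra! hlt
  nlinarith [norm_nonneg (a - b)]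

/-- Bounding the regret against every point of the game set bounds the duality gap. -/
theorem gap_le_of_forall_inner_le {n m : ℕ} (A : Matrix (Fin n) (Fin m) ℝ)
    (z : EuclideanSpace ℝ (Fin n ⊕ Fin m)) (c : ℝ) (hne : (gameSet n m).Nonempty)
    (h : ∀ s ∈ gameSet n m, -⟪Fop A z, s⟫_ℝ ≤ c) : gap A z ≤ c := by
  obtain ⟨s₀, hs₀, hl, hr⟩ := hne
  have hn : (simplex n).Nonempty :=
    ⟨WithLp.toLp 2 fun i => s₀ (Sum.inl i), fun i => hs₀ _, hl⟩
  have hm : (simplex m).Nonempty :=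
    ⟨WithLp.toLp 2 fun j => s₀ (Sum.inr j), fun j => hs₀ _, hr⟩
  rw [gap, sub_le_comm]
  refine le_csInf (hn.image _) ?_
  rintro _ ⟨x', hx', rfl⟩
  rw [sub_le_comm, sub_le_iff_le_add]
  refine csSup_le (hm.image _) ?_
  rintro _ ⟨y', hy', rfl⟩
  have := h (WithLp.toLp 2 (Sum.elim x' y'))
    ⟨by rintro (i | j); exacts [hx'.1 i, hy'.1 j], hx'.2, hy'.2⟩
  rw [inner_Fop] at this
  simp only [Sum.elim_inl, Sum.elim_inr] at this
  linarith

/-- The variational inequality satisfied by the projection of a zero of the residual. -/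
theorem inner_Fop_nonneg_of_residual_eq_zero {n m : ℕ} (A : Matrix (Fin n) (Fin m) ℝ)
    {γ : ℝ} (hγ : 0 < γ) {z w : EuclideanSpace ℝ (Fin n ⊕ Fin m)} (hw : w ∈ gameSet n m)
    (hmin : ∀ s ∈ gameSet n m, ‖z - w‖ ≤ ‖z - s‖)
    (hres : w - Matrix.toEuclideanLin (Mmat A γ)⁻¹ ((2 : ℝ) • w - z) = 0)
    {s : EuclideanSpace ℝ (Fin n ⊕ Fin m)} (hs : s ∈ gameSet n m) : 0 ≤ ⟪Fop A w, s⟫_ℝ := by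
  have hMw : Matrix.toEuclideanLin (Mmat A γ) w = (2 : ℝ) • w - z := by
    nth_rw 1 [sub_eq_zero.mp hres]
    rw [Matrix.toLpLin_apply, Matrix.toLpLin_apply, WithLp.ofLp_toLp, Matrix.mulVec_mulVec,
      Matrix.mul_nonsing_inv _ (isUnit_det_Mmat A γ), Matrix.one_mulVec, WithLp.toLp_ofLp]
  have hz : z - w = -(γ • Fop A w) := by
    rw [toEuclideanLin_Mmat] at hMw
    rw [eq_sub_iff_add_eq] at hMw
    rw [sub_eq_iff_eq_add, ← sub_eq_zero]
    rw [← sub_eq_zero] at hMw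
    rw [← hMw, two_smul]
    abel
  have := inner_sub_nearest_le_zero (convex_gameSet n m) hw hmin hs
  rw [hz, inner_neg_left, real_inner_smul_left, inner_sub_right, inner_Fop_self, sub_zero] at this
  exact nonneg_of_mul_nonneg_right (by linarith) hγ

theorem gap_le_of_error_bound {n m : ℕ} (A : Matrix (Fin n) (Fin m) ℝ)
    (γ : ℝ) (hγ : 0 < γ)
    (proj : EuclideanSpace ℝ (Fin n ⊕ Fin m) → EuclideanSpace ℝ (Fin n ⊕ Fin m))
    (hproj : ∀ z, proj z ∈ gameSet n m ∧ ∀ w ∈ gameSet n m, ‖z - proj z‖ ≤ ‖z - w‖)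
    (R : EuclideanSpace ℝ (Fin n ⊕ Fin m) → EuclideanSpace ℝ (Fin n ⊕ Fin m))
    (hR : ∀ z, R z = proj z - Matrix.toEuclideanLin (Mmat A γ)⁻¹ ((2 : ℝ) • proj z - z))
    (Zstar : Set (EuclideanSpace ℝ (Fin n ⊕ Fin m))) (hZstar : Zstar = {z | R z = 0})
    (hne : Zstar.Nonempty)
    (z : EuclideanSpace ℝ (Fin n ⊕ Fin m)) (τ : ℝ) (hτ : 0 < τ)
    (hlb : τ * Metric.infDist z Zstar ≤ ‖R z‖) :
    gap A (proj z) ≤ Real.sqrt 2 * opNorm A * ‖R z‖ / τ := by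
  have hC : 0 ≤ Real.sqrt 2 * opNorm A := mul_nonneg (Real.sqrt_nonneg _) (norm_nonneg _)
  have hbound : ∀ b ∈ Zstar, gap A (proj z) ≤ Real.sqrt 2 * opNorm A * dist z b := by
    intro b hb
    rw [hZstar, Set.mem_ofPred_eq, hR] at hb
    refine gap_le_of_forall_inner_le A _ _ ⟨proj z, (hproj z).1⟩ fun s hs => ?_
    have hvi := inner_Fop_nonneg_of_residual_eq_zero A hγ (hproj b).1 (hproj b).2 hb hs
    have hsplit : ⟪Fop A (proj z), s⟫_ℝ
        = ⟪Fop A (proj z - proj b), s⟫_ℝ + ⟪Fop A (proj b), s⟫_ℝ := by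
      rw [← inner_add_left, Fop, Fop, Fop, ← map_add, sub_add_cancel]
    calc -⟪Fop A (proj z), s⟫_ℝ ≤ |⟪Fop A (proj z - proj b), s⟫_ℝ| := by
          rw [hsplit]
          linarith [neg_abs_le ⟪Fop A (proj z - proj b), s⟫_ℝ]
      _ ≤ opNorm A * ‖proj z - proj b‖ * ‖s‖ := abs_inner_Fop_le A _ s
      _ ≤ opNorm A * ‖z - b‖ * Real.sqrt 2 := by
          have hA : 0 ≤ opNorm A := norm_nonneg _
          gcongr
          · exact norm_nearest_sub_nearest_le (convex_gameSet n m) (hproj z).1 (hproj b).1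
              (hproj z).2 (hproj b).2
          · exact norm_le_sqrt_two_of_mem_gameSet hs
      _ = Real.sqrt 2 * opNorm A * dist z b := by rw [dist_eq_norm]; ring
  have hinf : gap A (proj z) ≤ Real.sqrt 2 * opNorm A * Metric.infDist z Zstar := by
    rcases hC.eq_or_lt with h0 | hpos
    · obtain ⟨b, hb⟩ := hne
      simpa [← h0] using hbound b hb
    · rw [← div_le_iff₀' hpos, Metric.le_infDist hne]
      intro b hb
      rw [div_le_iff₀' hpos]
      exact hbound b hb
  calc gap A (proj z) ≤ Real.sqrt 2 * opNorm A * Metric.infDist z Zstar := hinf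
    _ ≤ Real.sqrt 2 * opNorm A * (‖R z‖ / τ) := by
        gcongr
        rwa [le_div_iff₀' hτ]
    _ = Real.sqrt 2 * opNorm A * ‖R z‖ / τ := by ring

end
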